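/- arXiv:quant-ph/0607141 — 5 statements merged into one kernel-verified Lean document; each statement's English description precedes it below -/
import Mathlib

section
/- Let ρ be a density matrix on ℂ^N and ε ≥ 0. Then the set Λ_B^ε(ρ) := {λ^↑(σ) : σ ∈ B^ε(ρ)} of ordered spectra of density matrices ε-close to ρ in trace distance is equal to the set Λ_D^ε(ρ) := {λ^↑(σ) : σ ∈ D^ε(ρ)} of ordered spectra of density matrices that commute with ρ and whose ordered spectrum is ε-close to that of ρ. -/
open Matrix
open scoped ComplexOrder
open Classical in
/-- The eigenvalues of a (Hermitian) matrix, listed in ascending order with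
multiplicity; junk value `0` for non-Hermitian matrices. -/
noncomputable def eigAsc {N : ℕ} (A : Matrix (Fin N) (Fin N) ℂ) : Fin N → ℝ :=
  if h : A.IsHermitian then fun i => h.eigenvalues (Tuple.sort h.eigenvalues i)
  else fun _ => 0

/-- The trace distance `‖A‖ = (1/2) ∑ᵢ |λᵢ^↑(A)|` (applied to `A = ρ - σ`). -/
noncomputable def trDist {N : ℕ} (A : Matrix (Fin N) (Fin N) ℂ) : ℝ :=
  (1 / 2) * ∑ i, |eigAsc A i|

/-- A density matrix: positive semidefinite with trace 1. -/
def IsDensity {N : ℕ} (ρ : Matrix (Fin N) (Fin N) ℂ) : Prop :=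
  ρ.PosSemidef ∧ ρ.trace = 1

/-- conjugated real diagonal matrix -/
noncomputable def cd {N : ℕ} (U : Matrix (Fin N) (Fin N) ℂ) (v : Fin N → ℝ) :
    Matrix (Fin N) (Fin N) ℂ := U * diagonal (fun i => (v i : ℂ)) * Uᴴ

lemma cd_perm {N : ℕ} (U : Matrix (Fin N) (Fin N) ℂ) (v : Fin N → ℝ) (τ : Equiv.Perm (Fin N)) :
    cd (U.submatrix id τ) (v ∘ τ) = cd U v := by
  ext i j
  unfold cd
  rw [Matrix.mul_apply, Matrix.mul_apply]
  simp only [Matrix.mul_diagonal, conjTranspose_apply, submatrix_apply, id, Function.comp]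
  exact Equiv.sum_comp τ (fun k => U i k * (v k : ℂ) * star (U j k))

lemma uni_perm {N : ℕ} (U : Matrix (Fin N) (Fin N) ℂ) (hU : Uᴴ * U = 1) (τ : Equiv.Perm (Fin N)) :
    (U.submatrix id τ)ᴴ * (U.submatrix id τ) = 1 := by
  have : (U.submatrix id τ)ᴴ * (U.submatrix id τ) = (Uᴴ * U).submatrix τ τ := by
    ext i j
    simp [Matrix.mul_apply]
  rw [this, hU]
  simp

lemma cd_herm {N : ℕ} (U : Matrix (Fin N) (Fin N) ℂ) (v : Fin N → ℝ) : (cd U v).IsHermitian := by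
  unfold cd
  apply isHermitian_mul_mul_conjTranspose
  rw [isHermitian_diagonal_iff]
  intro i
  simp [isSelfAdjoint_iff]

lemma cd_trace {N : ℕ} (U : Matrix (Fin N) (Fin N) ℂ) (hU : Uᴴ * U = 1) (v : Fin N → ℝ) :
    (cd U v).trace = ((∑ i, v i : ℝ) : ℂ) := by
  unfold cd
  rw [trace_mul_comm, ← mul_assoc, hU, one_mul, trace_diagonal]
  push_cast
  rfl

lemma cd_sub {N : ℕ} (U : Matrix (Fin N) (Fin N) ℂ) (v w : Fin N → ℝ) :
    cd U v - cd U w = cd U (v - w) := by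
  unfold cd
  rw [← sub_mul, ← mul_sub, diagonal_sub]
  simp

lemma cd_psd {N : ℕ} (U : Matrix (Fin N) (Fin N) ℂ) (v : Fin N → ℝ) (hv : ∀ i, 0 ≤ v i) :
    (cd U v).PosSemidef := by
  unfold cd
  apply PosSemidef.mul_mul_conjTranspose_same
  rw [posSemidef_diagonal_iff]
  intro i
  exact_mod_cast hv i

lemma cd_comm {N : ℕ} (U : Matrix (Fin N) (Fin N) ℂ) (hU : Uᴴ * U = 1) (v w : Fin N → ℝ) :
    cd U v * cd U w = cd U w * cd U v := by
  have key : ∀ v w : Fin N → ℝ, cd U v * cd U w =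
      U * (diagonal (fun i => (v i : ℂ)) * diagonal (fun i => (w i : ℂ))) * Uᴴ := by
    intro v w
    unfold cd
    calc _ = U * diagonal (fun i => (v i : ℂ)) * (Uᴴ * U) * diagonal (fun i => (w i : ℂ)) * Uᴴ := by
          simp only [mul_assoc]
      _ = _ := by rw [hU]; simp only [mul_assoc, mul_one]
  rw [key, key, diagonal_mul_diagonal, diagonal_mul_diagonal]
  simp only [mul_comm]

lemma cd_quad {N : ℕ} (U : Matrix (Fin N) (Fin N) ℂ) (v : Fin N → ℝ) (x : Fin N → ℂ) :
    star x ⬝ᵥ (cd U v *ᵥ x) = ((∑ i, v i * Complex.normSq ((Uᴴ *ᵥ x) i) : ℝ) : ℂ) := by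
  unfold cd
  rw [← mulVec_mulVec, ← mulVec_mulVec, dotProduct_mulVec]
  have : star x ᵥ* U = star (Uᴴ *ᵥ x) := by
    rw [star_mulVec, conjTranspose_conjTranspose]
  rw [this]
  simp only [dotProduct, mulVec_diagonal, Pi.star_apply]
  push_cast
  refine Finset.sum_congr rfl fun i _ => ?_
  rw [Complex.normSq_eq_conj_mul_self]
  simp only [starRingEnd_apply]
  ring

lemma cd_one {N : ℕ} (U : Matrix (Fin N) (Fin N) ℂ) (hU : Uᴴ * U = 1) (x : Fin N → ℂ) :
    star x ⬝ᵥ x = ((∑ i, Complex.normSq ((Uᴴ *ᵥ x) i) : ℝ) : ℂ) := by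
  have h := cd_quad U (fun _ => 1) x
  have h2 : cd U (fun _ => 1) = 1 := by
    simp [cd, mul_eq_one_comm.mp hU]
  rw [h2] at h
  simpa using h

lemma weyl {N : ℕ} (U V : Matrix (Fin N) (Fin N) ℂ) (hU : Uᴴ * U = 1) (hV : Vᴴ * V = 1)
    (a c : Fin N → ℝ) (ha : Monotone a) (hc : Monotone c) (h : (cd V c - cd U a).PosSemidef)
    (i : Fin N) : a i ≤ c i := by
  classical
  let M : Matrix (Fin N) (Fin N) ℂ :=
    Matrix.of fun j k => if j < i then Uᴴ j k else if i < j then Vᴴ j k else 0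
  have hM : M.det = 0 := by
    apply det_eq_zero_of_row_eq_zero i
    intro k
    simp [M]
  obtain ⟨x, hx0, hx⟩ := exists_mulVec_eq_zero_iff.mpr hM
  have h1 : ∀ j, j < i → (Uᴴ *ᵥ x) j = 0 := by
    intro j hj
    have := congrFun hx j
    simpa [M, mulVec, dotProduct, hj] using this
  have h2 : ∀ j, i < j → (Vᴴ *ᵥ x) j = 0 := by
    intro j hj
    have := congrFun hx j
    simpa [M, mulVec, dotProduct, hj, hj.not_gt] using this
  have hq := h.dotProduct_mulVec_nonneg x
  rw [sub_mulVec, dotProduct_sub, cd_quad, cd_quad, sub_nonneg] at hq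
  have hq' := Complex.real_le_real.mp hq
  have e1 := cd_one U hU x
  have e2 := cd_one V hV x
  have hpos : 0 < star x ⬝ᵥ x := dotProduct_star_self_pos_iff.mpr hx0
  have e3 := Complex.ofReal_injective (e1.symm.trans e2)
  rw [e1] at hpos
  have hpos' : 0 < ∑ i, Complex.normSq ((Uᴴ *ᵥ x) i) := by exact_mod_cast hpos
  have l1 : a i * ∑ j, Complex.normSq ((Uᴴ *ᵥ x) j) ≤
      ∑ j, a j * Complex.normSq ((Uᴴ *ᵥ x) j) := by
    rw [Finset.mul_sum]
    refine Finset.sum_le_sum fun j _ => ?_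
    rcases lt_or_ge j i with hj | hj
    · simp [h1 j hj]
    · exact mul_le_mul_of_nonneg_right (ha hj) (Complex.normSq_nonneg _)
  have l2 : ∑ j, c j * Complex.normSq ((Vᴴ *ᵥ x) j) ≤
      c i * ∑ j, Complex.normSq ((Vᴴ *ᵥ x) j) := by
    rw [Finset.mul_sum]
    refine Finset.sum_le_sum fun j _ => ?_
    rcases lt_or_ge i j with hj | hj
    · simp [h2 j hj]
    · exact mul_le_mul_of_nonneg_right (hc hj) (Complex.normSq_nonneg _)
  rw [← e3] at l2
  exact le_of_mul_le_mul_right (l1.trans (hq'.trans l2)) hpos'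

lemma eig_mono {N : ℕ} (A : Matrix (Fin N) (Fin N) ℂ) : Monotone (eigAsc A) := by
  unfold eigAsc
  split_ifs with h
  · exact Tuple.monotone_sort h.eigenvalues
  · exact monotone_const

lemma eig_decomp {N : ℕ} (A : Matrix (Fin N) (Fin N) ℂ) (hA : A.IsHermitian) :
    ∃ U : Matrix (Fin N) (Fin N) ℂ, Uᴴ * U = 1 ∧ A = cd U (eigAsc A) := by
  have hU : (hA.eigenvectorUnitary : Matrix (Fin N) (Fin N) ℂ)ᴴ * hA.eigenvectorUnitary = 1 :=
    Unitary.coe_star_mul_self hA.eigenvectorUnitary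
  refine ⟨_, uni_perm _ hU (Tuple.sort hA.eigenvalues), ?_⟩
  have e : eigAsc A = hA.eigenvalues ∘ (Tuple.sort hA.eigenvalues) := by
    unfold eigAsc
    rw [dif_pos hA]
    rfl
  rw [e, cd_perm]
  exact hA.spectral_theorem

lemma eig_unique {N : ℕ} (U : Matrix (Fin N) (Fin N) ℂ) (hU : Uᴴ * U = 1) (v : Fin N → ℝ)
    (hv : Monotone v) : eigAsc (cd U v) = v := by
  obtain ⟨V, hV, e⟩ := eig_decomp _ (cd_herm U v)
  have z : (0 : Matrix (Fin N) (Fin N) ℂ).PosSemidef := PosSemidef.zero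
  funext i
  apply le_antisymm
  · refine weyl V U hV hU _ _ (eig_mono _) hv ?_ i
    rw [← e, sub_self]; exact z
  · refine weyl U V hU hV _ _ hv (eig_mono _) ?_ i
    rw [← e, sub_self]; exact z

lemma trDist_cd {N : ℕ} (U : Matrix (Fin N) (Fin N) ℂ) (hU : Uᴴ * U = 1) (v : Fin N → ℝ) :
    trDist (cd U v) = (1 / 2) * ∑ i, |v i| := by
  unfold trDist
  rw [← cd_perm U v (Tuple.sort v),
    eig_unique _ (uni_perm U hU _) _ (Tuple.monotone_sort v)]
  congr 1
  exact Equiv.sum_comp (Tuple.sort v) (fun i => |v i|)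

lemma eig_sum {N : ℕ} (A : Matrix (Fin N) (Fin N) ℂ) (hA : A.IsHermitian) :
    A.trace = ((∑ i, eigAsc A i : ℝ) : ℂ) := by
  obtain ⟨U, hU, e⟩ := eig_decomp A hA
  conv_lhs => rw [e]
  exact cd_trace U hU _

lemma weyl' {N : ℕ} (A C : Matrix (Fin N) (Fin N) ℂ) (hA : A.IsHermitian) (hC : C.IsHermitian)
    (h : (C - A).PosSemidef) (i : Fin N) : eigAsc A i ≤ eigAsc C i := by
  obtain ⟨U, hU, e⟩ := eig_decomp A hA
  obtain ⟨V, hV, f⟩ := eig_decomp C hC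
  refine weyl U V hU hV _ _ (eig_mono _) (eig_mono _) ?_ i
  rw [← e, ← f]; exact h

lemma mirsky {N : ℕ} (A B : Matrix (Fin N) (Fin N) ℂ) (hA : A.IsHermitian) (hB : B.IsHermitian) :
    (1 / 2) * ∑ i, |eigAsc A i - eigAsc B i| ≤ trDist (A - B) := by
  obtain ⟨W, hW, e⟩ := eig_decomp (A - B) (hA.sub hB)
  unfold trDist
  set d := eigAsc (A - B) with hd
  have hC : (B + cd W (fun i => max (d i) 0)).IsHermitian := hB.add (cd_herm _ _)
  set C := B + cd W (fun i => max (d i) 0) with hCd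
  have hBC : (C - B).PosSemidef := by
    rw [hCd, add_sub_cancel_left]
    exact cd_psd _ _ fun i => le_max_right _ _
  have hAC : (C - A).PosSemidef := by
    have : C - A = cd W ((fun i => max (d i) 0) - d) := by
      rw [← cd_sub, ← e, hCd]; abel
    rw [this]
    exact cd_psd _ _ fun i => sub_nonneg.mpr (le_max_left _ _)
  have t1 : ∑ i, eigAsc C i = ∑ i, eigAsc B i + ∑ i, max (d i) 0 := by
    have := eig_sum C hC
    rw [hCd, trace_add, eig_sum B hB, cd_trace W hW, ← hCd] at this
    exact_mod_cast this.symm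
  have t2 : ∑ i, d i = ∑ i, eigAsc A i - ∑ i, eigAsc B i := by
    have := eig_sum (A - B) (hA.sub hB)
    rw [trace_sub, eig_sum A hA, eig_sum B hB, ← hd] at this
    exact_mod_cast this.symm
  have t3 : ∑ i, |d i| = 2 * ∑ i, max (d i) 0 - ∑ i, d i := by
    rw [Finset.mul_sum, ← Finset.sum_sub_distrib]
    refine Finset.sum_congr rfl fun i _ => ?_
    rcases le_total (d i) 0 with h | h
    · rw [abs_of_nonpos h, max_eq_right h]; ring
    · rw [abs_of_nonneg h, max_eq_left h]; ring
  have t4 : ∑ i, |eigAsc A i - eigAsc B i| ≤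
      ∑ i, (2 * eigAsc C i - eigAsc A i - eigAsc B i) := by
    refine Finset.sum_le_sum fun i _ => ?_
    have h1 := weyl' A C hA hC hAC i
    have h2 := weyl' B C hB hC hBC i
    rw [abs_le]
    constructor <;> linarith
  rw [Finset.sum_sub_distrib, Finset.sum_sub_distrib, ← Finset.mul_sum] at t4
  linarith

lemma eig_nonneg {N : ℕ} (A : Matrix (Fin N) (Fin N) ℂ) (hA : A.PosSemidef) (i : Fin N) :
    0 ≤ eigAsc A i := by
  unfold eigAsc
  rw [dif_pos hA.isHermitian]
  exact hA.eigenvalues_nonneg _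

/-- A density matrix with the spectrum of `σ`, diagonal in the ordered eigenbasis of `ρ`. -/
lemma exists_aligned {N : ℕ} (ρ σ : Matrix (Fin N) (Fin N) ℂ) (hρ : IsDensity ρ)
    (hσ : IsDensity σ) : ∃ σ', IsDensity σ' ∧ σ' * ρ = ρ * σ' ∧ eigAsc σ' = eigAsc σ ∧
      trDist (ρ - σ') = (1 / 2) * ∑ i, |eigAsc ρ i - eigAsc σ i| := by
  obtain ⟨U, hU, e⟩ := eig_decomp ρ hρ.1.isHermitian
  refine ⟨cd U (eigAsc σ), ⟨cd_psd _ _ (eig_nonneg σ hσ.1), ?_⟩, ?_,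
    eig_unique U hU _ (eig_mono σ), ?_⟩
  · rw [cd_trace U hU, ← eig_sum σ hσ.1.isHermitian, hσ.2]
  · rw [e]; exact cd_comm U hU _ _
  · have : ρ - cd U (eigAsc σ) = cd U (eigAsc ρ - eigAsc σ) := by
      rw [← cd_sub, ← e]
    rw [this, trDist_cd U hU]
    rfl

/-- The set of ordered spectra of density matrices ε-close to ρ in
trace distance equals the set of ordered spectra of density matrices commuting with ρ
whose ordered spectrum is ε-close to that of ρ. -/
theorem stmt0 {N : ℕ} (ρ : Matrix (Fin N) (Fin N) ℂ) (hρ : IsDensity ρ)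
    (ε : ℝ) (hε : 0 ≤ ε) :
    {v : Fin N → ℝ | ∃ σ, IsDensity σ ∧ trDist (ρ - σ) ≤ ε ∧ eigAsc σ = v} =
    {v : Fin N → ℝ | ∃ σ, IsDensity σ ∧ σ * ρ = ρ * σ ∧
      (1 / 2) * ∑ i, |eigAsc ρ i - eigAsc σ i| ≤ ε ∧ eigAsc σ = v} := by
  ext v
  simp only [Set.mem_setOf_eq]
  constructor
  · rintro ⟨σ, hσ, hd, rfl⟩
    obtain ⟨σ', h1, h2, h3, -⟩ := exists_aligned ρ σ hρ hσ
    refine ⟨σ', h1, h2, ?_, h3⟩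
    rw [h3]
    exact (mirsky ρ σ hρ.1.isHermitian hσ.1.isHermitian).trans hd
  · rintro ⟨σ, hσ, -, hd, rfl⟩
    obtain ⟨σ', h1, -, h3, h4⟩ := exists_aligned ρ σ hρ hσ
    exact ⟨σ', h1, h4.trans_le hd, h3⟩
end

section
/- Define the vector |Ψ⟩ ∈ ℂ^d ⊗ ℂ^d ⊗ ℂ^m by |Ψ⟩ = √(β0/d) ∑_{k} |kk⟩|E_kk⟩ + √(β1/d) ∑_{k≠l} |kl⟩|E_kl⟩, i.e. Ψ_{(i,j,e)} = √(β0/d)·(E_ii)_e if i = j and √(β1/d)·(E_ij)_e if i ≠ j. Then |Ψ⟩ is a unit vector and is a purification of ρ_AB: for all indices (i,j),(k,l) ∈ (Fin d)×(Fin d), ∑_{e∈Fin m} Ψ_{(i,j,e)} · conj(Ψ_{(k,l,e)}) = (ρ_AB)_{(i,j),(k,l)}, where ρ_AB := (β0−β1)|φ_d^+⟩⟨φ_d^+| + (β1/d)·𝟙 with |φ_d^+⟩ = (1/√d)∑_{x}|xx⟩. -/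
open Matrix
open scoped ComplexOrder

/-- The maximally entangled state `|φ_d⁺⟩ = (1/√d) ∑ₓ |xx⟩` in `ℂ^d ⊗ ℂ^d`. -/
noncomputable def phiPlus (d : ℕ) : (Fin d × Fin d) → ℂ :=
  fun p => if p.1 = p.2 then ((1 / Real.sqrt d : ℝ) : ℂ) else 0

/-- The state `ρ_AB = (β0 - β1)|φ_d⁺⟩⟨φ_d⁺| + (β1/d)·𝟙`. -/
noncomputable def rhoAB (d : ℕ) (β0 β1 : ℝ) :
    Matrix (Fin d × Fin d) (Fin d × Fin d) ℂ :=
  ((β0 - β1 : ℝ) : ℂ) • Matrix.vecMulVec (phiPlus d) (star (phiPlus d)) +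
    ((β1 / d : ℝ) : ℂ) • (1 : Matrix (Fin d × Fin d) (Fin d × Fin d) ℂ)

/-- The vector `|Ψ⟩ = √(β0/d) ∑ₖ |kk⟩|E_kk⟩ + √(β1/d) ∑_{k≠l} |kl⟩|E_kl⟩`
is a unit vector and a purification of ρ_AB: tracing out Eve's system recovers ρ_AB. -/
theorem stmt8 (d m : ℕ) (hd : 2 ≤ d) (β0 β1 : ℝ)
    (hβ1 : 0 < β1) (h1 : β1 < 1 / d) (h2 : 1 / d < β0) (h3 : β0 ≤ 1)
    (hnorm : β0 + ((d : ℝ) - 1) * β1 = 1)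
    (E : Fin d → Fin d → Fin m → ℂ)
    (hunit : ∀ k l, ∑ e, star (E k l e) * E k l e = 1)
    (hdiag : ∀ k l, k ≠ l → ∑ e, star (E k k e) * E l l e = ((1 - β1 / β0 : ℝ) : ℂ))
    (horth : ∀ k l k' l', k ≠ l → (k, l) ≠ (k', l') →
      ∑ e, star (E k l e) * E k' l' e = 0)
    (Ψ : Fin d × Fin d × Fin m → ℂ)
    (hΨ : ∀ i j e, Ψ (i, j, e) =
      (if i = j then ((Real.sqrt (β0 / d) : ℝ) : ℂ) else ((Real.sqrt (β1 / d) : ℝ) : ℂ)) *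
        E i j e) :
    (∑ p, star (Ψ p) * Ψ p) = 1 ∧
    ∀ i j k l, (∑ e, Ψ (i, j, e) * star (Ψ (k, l, e))) = rhoAB d β0 β1 (i, j) (k, l) := by
  have hdpos : (0 : ℝ) < d := by
    have : 0 < d := by omega
    exact_mod_cast this
  have hβ0 : 0 < β0 := lt_trans (by positivity) h2
  have hdC : (d : ℂ) ≠ 0 := by exact_mod_cast hdpos.ne'
  have hβ0C : (β0 : ℂ) ≠ 0 := by exact_mod_cast hβ0.ne'
  have s0 : ((Real.sqrt (β0 / d) : ℝ) : ℂ) * ((Real.sqrt (β0 / d) : ℝ) : ℂ) = β0 / d := by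
    rw [← Complex.ofReal_mul, Real.mul_self_sqrt (by positivity)]; push_cast; rfl
  have s1 : ((Real.sqrt (β1 / d) : ℝ) : ℂ) * ((Real.sqrt (β1 / d) : ℝ) : ℂ) = β1 / d := by
    rw [← Complex.ofReal_mul, Real.mul_self_sqrt (by positivity)]; push_cast; rfl
  have sd : ((1 / Real.sqrt d : ℝ) : ℂ) * ((1 / Real.sqrt d : ℝ) : ℂ) = 1 / d := by
    rw [← Complex.ofReal_mul, div_mul_div_comm, Real.mul_self_sqrt hdpos.le]; push_cast; simp
  have horth' : ∀ k l k' l', k ≠ l → (k, l) ≠ (k', l') →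
      ∑ e, star (E k' l' e) * E k l e = 0 := by
    intro k l k' l' h h'
    have := congrArg star (horth k l k' l' h h')
    rw [star_sum, star_zero] at this
    rw [← this]
    refine Finset.sum_congr rfl fun e _ => ?_
    rw [star_mul, star_star]
  have key : ∀ i j k l, (∑ e, Ψ (i, j, e) * star (Ψ (k, l, e))) =
      (if i = j then ((Real.sqrt (β0 / d) : ℝ) : ℂ) else ((Real.sqrt (β1 / d) : ℝ) : ℂ)) *
      (if k = l then ((Real.sqrt (β0 / d) : ℝ) : ℂ) else ((Real.sqrt (β1 / d) : ℝ) : ℂ)) *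
      ∑ e, star (E k l e) * E i j e := by
    intro i j k l
    rw [Finset.mul_sum]
    refine Finset.sum_congr rfl fun e _ => ?_
    rw [hΨ, hΨ, star_mul]
    have : star (if k = l then ((Real.sqrt (β0 / d) : ℝ) : ℂ)
        else ((Real.sqrt (β1 / d) : ℝ) : ℂ)) =
        (if k = l then ((Real.sqrt (β0 / d) : ℝ) : ℂ)
        else ((Real.sqrt (β1 / d) : ℝ) : ℂ)) := by
      split_ifs <;> exact Complex.conj_ofReal _
    rw [this]; ring
  have hrho : ∀ i j k l, rhoAB d β0 β1 (i, j) (k, l) =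
      ((β0 : ℂ) - β1) * (if i = j ∧ k = l then 1 / (d : ℂ) else 0) +
        β1 / d * (if i = k ∧ j = l then 1 else 0) := by
    intro i j k l
    have hs : star ((1 / Real.sqrt d : ℝ) : ℂ) = ((1 / Real.sqrt d : ℝ) : ℂ) :=
      Complex.conj_ofReal _
    simp only [rhoAB, Matrix.add_apply, Matrix.smul_apply, Matrix.vecMulVec_apply, phiPlus,
      Pi.star_apply, Matrix.one_apply, Prod.mk.injEq, smul_eq_mul]
    congr 1
    · by_cases h : i = j <;> by_cases h' : k = l
      · simp only [h, h', if_true, and_self]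
        rw [hs, sd]; push_cast; rfl
      all_goals simp [h, h']
    · push_cast; rfl
  have main : ∀ i j k l, (∑ e, Ψ (i, j, e) * star (Ψ (k, l, e))) =
      rhoAB d β0 β1 (i, j) (k, l) := by
    intro i j k l
    rw [key, hrho]
    by_cases hp : (i, j) = (k, l)
    · obtain ⟨rfl, rfl⟩ := Prod.mk.inj hp
      rw [hunit]
      by_cases h : i = j
      · simp only [h, if_true, and_self]
        rw [s0]; field_simp; ring
      · simp only [h, if_false, if_true, and_self]
        rw [s1]; ring
    · have hp' : ¬ (i = k ∧ j = l) := fun h => hp (Prod.ext h.1 h.2)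
      rw [if_neg hp']
      by_cases h : i = j
      · by_cases h' : k = l
        · subst h; subst h'
          have hik : k ≠ i := fun h => hp' ⟨h.symm, h.symm⟩
          rw [hdiag k i hik]
          simp only [if_true, and_self]
          rw [s0]; push_cast; field_simp; ring
        · rw [horth k l i j h' (Ne.symm hp)]; simp [h']
      · rw [horth' i j k l h hp]; simp [h]
  refine ⟨?_, main⟩
  have hsum : (∑ p, star (Ψ p) * Ψ p) = ∑ i, ∑ j, rhoAB d β0 β1 (i, j) (i, j) := by
    rw [Fintype.sum_prod_type]
    refine Finset.sum_congr rfl fun i _ => ?_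
    rw [Fintype.sum_prod_type]
    refine Finset.sum_congr rfl fun j _ => ?_
    rw [← main]
    exact Finset.sum_congr rfl fun e _ => mul_comm _ _
  have hn : (β0 : ℂ) + ((d : ℂ) - 1) * β1 = 1 := by exact_mod_cast congrArg Complex.ofReal hnorm
  rw [hsum]
  simp only [hrho, and_self, if_true, Finset.sum_add_distrib, ← Finset.mul_sum,
    Finset.sum_ite_eq, Finset.mem_univ, Finset.sum_const, Finset.card_univ, Fintype.card_fin,
    nsmul_eq_mul]
  field_simp
  linear_combination hn
end

section
/- Define the m×m matrix ρ_E := (1/d)(β0 ∑_{x} |E_xx⟩⟨E_xx| + β1 ∑_{x≠y} |E_xy⟩⟨E_xy|). Then ρ_E is positive semidefinite with trace 1, and its nonzero spectrum consists of the eigenvalue β0 − β1 + β1/d with multiplicity 1 and the eigenvalue β1/d with multiplicity d² − 1; in particular rank ρ_E = d². -/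
open Matrix
open scoped ComplexOrder

/-- Eve's state `ρ_E = (1/d)(β0 ∑ₓ |E_xx⟩⟨E_xx| + β1 ∑_{x≠y} |E_xy⟩⟨E_xy|)`. -/
noncomputable def rhoE (d m : ℕ) (β0 β1 : ℝ) (E : Fin d → Fin d → Fin m → ℂ) :
    Matrix (Fin m) (Fin m) ℂ :=
  ((1 / d : ℝ) : ℂ) •
    (((β0 : ℝ) : ℂ) • ∑ x, Matrix.vecMulVec (E x x) (star (E x x)) +
     ((β1 : ℝ) : ℂ) • ∑ p ∈ Finset.univ.filter (fun p : Fin d × Fin d => p.1 ≠ p.2),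
        Matrix.vecMulVec (E p.1 p.2) (star (E p.1 p.2)))

lemma rhoE_posSemidef (d m : ℕ) (β0 β1 : ℝ) (h0 : 0 ≤ β0) (h1 : 0 ≤ β1)
    (E : Fin d → Fin d → Fin m → ℂ) : (rhoE d m β0 β1 E).PosSemidef := by
  unfold rhoE
  have hd : (0 : ℝ) ≤ 1 / d := by positivity
  refine Matrix.PosSemidef.smul (Matrix.PosSemidef.add (Matrix.PosSemidef.smul ?_ ?_)
    (Matrix.PosSemidef.smul ?_ ?_)) ?_
  · exact Matrix.posSemidef_sum _ fun i _ => Matrix.posSemidef_vecMulVec_self_star _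
  · exact_mod_cast h0
  · exact Matrix.posSemidef_sum _ fun i _ => Matrix.posSemidef_vecMulVec_self_star _
  · exact_mod_cast h1
  · exact_mod_cast hd

/-- weights -/
noncomputable def wgt (d : ℕ) (β0 β1 : ℝ) (p : Fin d × Fin d) : ℂ :=
  if p.1 = p.2 then ((β0 / d : ℝ) : ℂ) else ((β1 / d : ℝ) : ℂ)

/-- left factor -/
noncomputable def facA (d m : ℕ) (β0 β1 : ℝ) (E : Fin d → Fin d → Fin m → ℂ) :
    Matrix (Fin m) (Fin d × Fin d) ℂ := Matrix.of fun e p => wgt d β0 β1 p * E p.1 p.2 e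

/-- right factor -/
noncomputable def facB (d m : ℕ) (E : Fin d → Fin d → Fin m → ℂ) :
    Matrix (Fin d × Fin d) (Fin m) ℂ := Matrix.of fun p e => star (E p.1 p.2 e)

/-- indicator of the diagonal -/
noncomputable def dvec (d : ℕ) (p : Fin d × Fin d) : ℂ := if p.1 = p.2 then 1 else 0

lemma rhoE_eq (d m : ℕ) (β0 β1 : ℝ) (E : Fin d → Fin d → Fin m → ℂ) :
    rhoE d m β0 β1 E = facA d m β0 β1 E * facB d m E := by
  ext i j
  simp only [rhoE, facA, facB, Matrix.mul_apply, Matrix.smul_apply, Matrix.add_apply,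
    Matrix.sum_apply, Matrix.vecMulVec_apply, Matrix.of_apply, smul_eq_mul, Pi.star_apply]
  have hs : ∑ x, E x x i * star (E x x j) =
      ∑ p ∈ Finset.univ.filter (fun p : Fin d × Fin d => p.1 = p.2),
        E p.1 p.2 i * star (E p.1 p.2 j) := by
    rw [Finset.sum_filter, Fintype.sum_prod_type]
    simp
  rw [hs, ← Finset.sum_filter_add_sum_filter_not Finset.univ
    (fun p : Fin d × Fin d => p.1 = p.2) (fun p => wgt d β0 β1 p * E p.1 p.2 i * _),
    mul_add, Finset.mul_sum, Finset.mul_sum, Finset.mul_sum, Finset.mul_sum]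
  congr 1
  · refine Finset.sum_congr rfl fun p hp => ?_
    have : p.1 = p.2 := by simpa using hp
    simp [wgt, this]; ring
  · refine Finset.sum_congr rfl fun p hp => ?_
    have : p.1 ≠ p.2 := by simpa using hp
    simp [wgt, this]; ring

lemma gram_eq (d m : ℕ) (β0 β1 : ℝ) (h0 : 0 < β0)
    (E : Fin d → Fin d → Fin m → ℂ)
    (hunit : ∀ k l, ∑ e, star (E k l e) * E k l e = 1)
    (hdiag : ∀ k l, k ≠ l → ∑ e, star (E k k e) * E l l e = ((1 - β1 / β0 : ℝ) : ℂ))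
    (horth : ∀ k l k' l', k ≠ l → (k, l) ≠ (k', l') →
      ∑ e, star (E k l e) * E k' l' e = 0) :
    facB d m E * facA d m β0 β1 E - Matrix.scalar _ ((β1 / d : ℝ) : ℂ) =
      Matrix.vecMulVec ((((β0 - β1) / d : ℝ) : ℂ) • dvec d) (dvec d) := by
  have h0' : (β0 : ℂ) ≠ 0 := by exact_mod_cast h0.ne'
  ext ⟨a, b⟩ ⟨k, l⟩
  have key : (facB d m E * facA d m β0 β1 E) (a, b) (k, l) =
      wgt d β0 β1 (k, l) * ∑ e, star (E a b e) * E k l e := by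
    simp only [facA, facB, Matrix.mul_apply, Matrix.of_apply, Finset.mul_sum]
    exact Finset.sum_congr rfl fun e _ => by ring
  rw [Matrix.sub_apply, key, Matrix.scalar_apply, Matrix.vecMulVec_apply, Matrix.diagonal_apply]
  by_cases hpq : ((a, b) : Fin d × Fin d) = (k, l)
  · obtain ⟨rfl, rfl⟩ := Prod.mk.inj hpq
    rw [hunit]
    by_cases hab : a = b
    · simp [wgt, dvec, hab]; ring
    · simp [wgt, dvec, hab]
  · rw [if_neg hpq]
    by_cases hab : a = b
    · by_cases hkl : k = l
      · subst hab hkl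
        rw [hdiag a k (by rintro rfl; exact hpq rfl)]
        simp [wgt, dvec]
        field_simp
      · have h := congrArg star (horth k l a b hkl (Ne.symm hpq))
        have h' : ∑ e, star (E a b e) * E k l e = 0 := by
          rw [star_sum, star_zero] at h
          rw [← h]
          exact Finset.sum_congr rfl fun e _ => by simp [mul_comm]
        rw [h']
        simp [dvec, hkl]
    · rw [horth a b k l hab hpq]
      simp [dvec, hab]

lemma dvec_dot (d : ℕ) : dvec d ⬝ᵥ dvec d = d := by
  simp [dotProduct, dvec, Fintype.sum_prod_type]

open Polynomial in
lemma gram_charpoly (d : ℕ) (hd : 2 ≤ d) (G : Matrix (Fin d × Fin d) (Fin d × Fin d) ℂ) (c s : ℂ)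
    (h : G - Matrix.scalar _ c = Matrix.vecMulVec (s • dvec d) (dvec d)) :
    G.charpoly = (X - C c) ^ (d ^ 2 - 1) * (X - C (c + s * d)) := by
  have e : G.charpoly = (G - Matrix.scalar _ c).charpoly.comp (X - C c) := by
    rw [Matrix.charpoly_sub_scalar, comp_assoc]; simp
  have hn : d ^ 2 = (d ^ 2 - 1) + 1 := by
    have : 0 < d ^ 2 := by positivity
    omega
  have hc : Fintype.card (Fin d × Fin d) = d ^ 2 := by simp [sq]
  rw [e, h, Matrix.charpoly_vecMulVec, hc, smul_dotProduct, dvec_dot]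
  generalize d ^ 2 - 1 = n at *
  rw [hn]
  simp [smul_eq_C_mul]
  ring

/-- ρ_E is positive semidefinite with trace 1; its nonzero spectrum
consists of the eigenvalue `β0 - β1 + β1/d` with multiplicity 1 and `β1/d` with
multiplicity `d² - 1`; in particular `rank ρ_E = d²`. -/
theorem stmt9 (d m : ℕ) (hd : 2 ≤ d) (β0 β1 : ℝ)
    (hβ1 : 0 < β1) (h1 : β1 < 1 / d) (h2 : 1 / d < β0) (h3 : β0 ≤ 1)
    (hnorm : β0 + ((d : ℝ) - 1) * β1 = 1)
    (E : Fin d → Fin d → Fin m → ℂ)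
    (hunit : ∀ k l, ∑ e, star (E k l e) * E k l e = 1)
    (hdiag : ∀ k l, k ≠ l → ∑ e, star (E k k e) * E l l e = ((1 - β1 / β0 : ℝ) : ℂ))
    (horth : ∀ k l k' l', k ≠ l → (k, l) ≠ (k', l') →
      ∑ e, star (E k l e) * E k' l' e = 0) :
    (rhoE d m β0 β1 E).PosSemidef ∧ (rhoE d m β0 β1 E).trace = 1 ∧
    (∃ h : (rhoE d m β0 β1 E).IsHermitian,
      (Finset.univ.val.map h.eigenvalues).filter (· ≠ 0) =
        (β0 - β1 + β1 / d) ::ₘ Multiset.replicate (d ^ 2 - 1) (β1 / d)) ∧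
    (rhoE d m β0 β1 E).rank = d ^ 2 := by
  have hd0 : (0 : ℝ) < d := by positivity
  have h0 : 0 < β0 := lt_trans (by positivity) h2
  have hpsd := rhoE_posSemidef d m β0 β1 h0.le hβ1.le E
  have hgram := gram_eq d m β0 β1 h0 E hunit hdiag horth
  have hchar := gram_charpoly d hd _ _ _ hgram
  have htr : (rhoE d m β0 β1 E).trace = 1 := by
    rw [rhoE_eq, Matrix.trace_mul_comm]
    have hG := sub_eq_iff_eq_add.mp hgram
    have hnc : (β0 : ℂ) + ((d : ℂ) - 1) * β1 = 1 := by exact_mod_cast hnorm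
    have hdc : (d : ℂ) ≠ 0 := by exact_mod_cast hd0.ne'
    rw [hG, Matrix.trace_add, Matrix.trace_vecMulVec, smul_dotProduct, dvec_dot]
    simp [Matrix.trace]
    field_simp
    linear_combination hnc
  have hnz1 : β0 - β1 + β1 / d ≠ 0 := by
    have : 0 < β1 / d := by positivity
    linarith
  have hnz2 : β1 / d ≠ 0 := by positivity
  have hH := hpsd.1
  have hspec : (Finset.univ.val.map hH.eigenvalues).filter (· ≠ 0) =
        (β0 - β1 + β1 / d) ::ₘ Multiset.replicate (d ^ 2 - 1) (β1 / d) := by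
    have hm := Matrix.charpoly_mul_comm' (facA d m β0 β1 E) (facB d m E)
    rw [← rhoE_eq, hchar] at hm
    have hr := congrArg Polynomial.roots hm
    have hne1 := (Matrix.charpoly_monic (rhoE d m β0 β1 E)).ne_zero
    rw [Polynomial.roots_mul (mul_ne_zero (pow_ne_zero _ Polynomial.X_ne_zero) hne1),
      Polynomial.roots_mul (mul_ne_zero (pow_ne_zero _ Polynomial.X_ne_zero)
        (mul_ne_zero (pow_ne_zero _ (Polynomial.X_sub_C_ne_zero _))
          (Polynomial.X_sub_C_ne_zero _))),
      Polynomial.roots_mul (mul_ne_zero (pow_ne_zero _ (Polynomial.X_sub_C_ne_zero _))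
          (Polynomial.X_sub_C_ne_zero _)),
      hH.roots_charpoly_eq_eigenvalues] at hr
    simp only [Polynomial.roots_pow, Polynomial.roots_X, Polynomial.roots_X_sub_C,
      Multiset.nsmul_singleton] at hr
    have hr2 := congrArg (fun s => (s.map Complex.re).filter (· ≠ 0)) hr
    have hcs : (((β1 / d : ℝ) : ℂ) + (((β0 - β1) / d : ℝ) : ℂ) * d).re = β0 - β1 + β1 / d := by
      have : (((β1 / d : ℝ) : ℂ) + (((β0 - β1) / d : ℝ) : ℂ) * d)
          = ((β0 - β1 + β1 / d : ℝ) : ℂ) := by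
        have hdc : (d : ℂ) ≠ 0 := by exact_mod_cast hd0.ne'
        push_cast
        field_simp
        ring
      rw [this, Complex.ofReal_re]
    simp only [Multiset.map_add, Multiset.filter_add, Multiset.map_replicate, Multiset.map_map,
      Multiset.map_singleton, hcs, Complex.zero_re, Complex.ofReal_re] at hr2
    have hz : ∀ n, (Multiset.replicate n (0 : ℝ)).filter (· ≠ 0) = 0 := by
      intro n
      rw [Multiset.filter_eq_nil]
      intro a ha
      simp [Multiset.eq_of_mem_replicate ha]
    have hy : ∀ n, (Multiset.replicate n (β1 / d : ℝ)).filter (· ≠ 0)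
        = Multiset.replicate n (β1 / d : ℝ) := by
      intro n
      rw [Multiset.filter_eq_self]
      intro a ha
      rw [Multiset.eq_of_mem_replicate ha]
      exact hnz2
    rw [hz, hz, hy, Multiset.filter_singleton, if_pos hnz1, zero_add, zero_add, add_comm,
      Multiset.singleton_add] at hr2
    exact hr2
  refine ⟨hpsd, htr, ⟨hH, hspec⟩, ?_⟩
  rw [hH.rank_eq_card_non_zero_eigs]
  have hcard := congrArg Multiset.card hspec
  rw [Multiset.card_cons, Multiset.card_replicate, Multiset.filter_map, Multiset.card_map] at hcard
  have hn : 0 < d ^ 2 := by positivity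
  rw [Fintype.card_subtype]
  calc _ = _ := rfl
    _ = d ^ 2 - 1 + 1 := hcard
    _ = d ^ 2 := by omega
end

section
/- Let λ ∈ ℝ^N be ascending (λ_1 ≤ … ≤ λ_N) with λ_i ≥ 0 and ∑_i λ_i = 1, and let ε ≥ 0. Suppose there are indices 1 ≤ a < c ≤ N and reals x, y with x ≤ y such that: ∑_{i=1}^{a}(x − λ_i) = ε with λ_a ≤ x and (if a < N) x ≤ λ_{a+1}; and ∑_{i=c}^{N}(λ_i − y) = ε with y ≤ λ_c and (if c > 1) λ_{c−1} ≤ y. Define μ ∈ ℝ^N by μ_i = x for i ≤ a, μ_i = λ_i for a < i < c, and μ_i = y for i ≥ c. Then for every ν ∈ ℝ^N with ν_i ≥ 0, ∑_i ν_i = 1, and (1/2)∑_i |λ_i − ν_i| ≤ ε, one has ∑_i μ_i² ≤ ∑_i ν_i². In other words, the 'clipped' vector μ minimizes the sum of squares (and hence achieves inf_{σ∈B^ε(ρ)} tr σ² when λ is the spectrum of a density matrix ρ). -/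
/-- Let λ be an ascending probability vector, and let μ be obtained
from λ by raising the smallest `a` entries to a common value `x` (at total cost ε) and
lowering the entries from position `c` on to a common value `y` (at total cost ε),
with `x ≤ y`, the raised entries not exceeding the next entry and the lowered entries
not below the previous entry. Then μ minimizes the sum of squares among all probability
vectors within variational distance ε of λ. (Indices are 1-based: entry `i : Fin N`
corresponds to position `i + 1`.) -/
theorem stmt15 (N : ℕ) (lam : Fin N → ℝ) (hmono : Monotone lam)
    (hnn : ∀ i, 0 ≤ lam i) (hsum : ∑ i, lam i = 1)
    (ε : ℝ) (hε : 0 ≤ ε)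
    (a c : ℕ) (ha1 : 1 ≤ a) (hac : a < c) (hcN : c ≤ N)
    (x y : ℝ) (hxy : x ≤ y)
    (hxsum : (∑ i : Fin N, if (i : ℕ) + 1 ≤ a then x - lam i else 0) = ε)
    (hxlo : lam ⟨a - 1, by omega⟩ ≤ x)
    (hxhi : ∀ h : a < N, x ≤ lam ⟨a, h⟩)
    (hysum : (∑ i : Fin N, if c ≤ (i : ℕ) + 1 then lam i - y else 0) = ε)
    (hyhi : y ≤ lam ⟨c - 1, by omega⟩)
    (hylo : 1 < c → lam ⟨c - 2, by omega⟩ ≤ y)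
    (μ : Fin N → ℝ)
    (hμ : ∀ i : Fin N, μ i =
      if (i : ℕ) + 1 ≤ a then x else if (i : ℕ) + 1 < c then lam i else y) :
    ∀ ν : Fin N → ℝ, (∀ i, 0 ≤ ν i) → (∑ i, ν i = 1) →
      (1 / 2) * (∑ i, |lam i - ν i|) ≤ ε →
      ∑ i, (μ i) ^ 2 ≤ ∑ i, (ν i) ^ 2 := by
  intro ν _ hν1 hνd
  have key : ∀ i : Fin N, 2 * (-x * (if (i : ℕ) + 1 ≤ a then x - lam i else 0)
      + y * (if c ≤ (i : ℕ) + 1 then lam i - y else 0)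
      + (x + y) / 2 * (ν i - lam i) - (y - x) / 2 * |lam i - ν i|) ≤ (ν i) ^ 2 - (μ i) ^ 2 := by
    intro i
    have hb : x ≤ μ i ∧ μ i ≤ y := by
      rw [hμ i]
      split_ifs with h1 h2
      · exact ⟨le_rfl, hxy⟩
      · refine ⟨(hxhi (by omega)).trans (hmono ?_), le_trans (hmono ?_) (hylo (by omega))⟩
        · rw [Fin.le_def]; simp only; omega
        · rw [Fin.le_def]; simp only; omega
      · exact ⟨hxy, le_rfl⟩
    have h3 : μ i * (lam i - μ i) = -x * (if (i : ℕ) + 1 ≤ a then x - lam i else 0)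
      + y * (if c ≤ (i : ℕ) + 1 then lam i - y else 0) := by
      rw [hμ i]
      split_ifs <;> first | omega | ring
    have h4 : -((y - x) / 2 * |lam i - ν i|) ≤ (μ i - (x + y) / 2) * (ν i - lam i) := by
      have e : |(μ i - (x + y) / 2) * (ν i - lam i)| ≤ (y - x) / 2 * |lam i - ν i| := by
        rw [abs_mul, abs_sub_comm (ν i)]
        refine mul_le_mul_of_nonneg_right ?_ (abs_nonneg _)
        rw [abs_le]
        constructor <;> linarith [hb.1, hb.2]
      exact (abs_le.mp e).1
    rw [← h3]
    nlinarith [sq_nonneg (ν i - μ i)]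
  have S := Finset.sum_le_sum (fun i (_ : i ∈ Finset.univ) => key i)
  rw [← Finset.mul_sum, Finset.sum_sub_distrib, Finset.sum_sub_distrib, Finset.sum_add_distrib,
    Finset.sum_add_distrib, ← Finset.mul_sum, ← Finset.mul_sum, ← Finset.mul_sum, ← Finset.mul_sum,
    hxsum, hysum, Finset.sum_sub_distrib, hν1, hsum] at S
  have h5 := mul_le_mul_of_nonneg_left hνd (sub_nonneg.mpr hxy)
  nlinarith
end

section
/- Let 0 < p_0 < p_1 < … < p_n be reals, let n_0, …, n_n be positive integers, and consider the multiset containing each p_l with multiplicity n_l. For 0 ≤ r ≤ n+1 set s_r := ∑_{i=1}^{r} n_{n−i+1} p_{n−i+1} (the sum of the r largest distinct values counted with multiplicity), let 0 ≤ ε < 1 with s_{n+1} ≥ 1−ε, and let b := min{r : s_r ≥ 1−ε}; assume b ≥ 1. Then the smallest integer k such that the sum of the k largest elements of the multiset is at least 1−ε equals k = ∑_{i=1}^{b} n_{n−i+1} − ⌊(s_b − (1−ε))/p_{n−b+1}⌋. -/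
lemma aux_list (A B : List ℝ) (m : ℕ) (q T : ℝ) (hq : 0 < q) (hA : A.sum < T)
    (hT : T ≤ A.sum + m * q) (hA0 : ∀ x ∈ A, 0 ≤ x) (k : ℕ)
    (hk : k = A.length + m - Nat.floor ((A.sum + m * q - T) / q)) :
    T ≤ ((A ++ (List.replicate m q ++ B)).take k).sum ∧
    ∀ j, T ≤ ((A ++ (List.replicate m q ++ B)).take j).sum → k ≤ j := by
  have hx0 : 0 ≤ (A.sum + m * q - T) / q := div_nonneg (by linarith) hq.le
  have h1 := Nat.floor_le hx0
  have h2 := Nat.lt_floor_add_one ((A.sum + m * q - T) / q)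
  set f := Nat.floor ((A.sum + m * q - T) / q) with hf
  rw [le_div_iff₀ hq] at h1
  rw [div_lt_iff₀ hq] at h2
  have hfm : f < m := by
    have : (f : ℝ) * q < m * q := by linarith
    exact_mod_cast lt_of_mul_lt_mul_right this hq.le
  have key : ∀ t, t ≤ m → (A ++ (List.replicate m q ++ B)).take (A.length + t)
      = A ++ List.replicate t q := by
    intro t ht
    rw [List.take_length_add_append, List.take_append_of_le_length (by simpa using ht),
      List.take_replicate, min_eq_left ht]
  constructor
  · have hk' : k = A.length + (m - f) := by omega
    rw [hk', key _ (by omega)]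
    simp only [List.sum_append, List.sum_replicate, nsmul_eq_mul]
    rw [Nat.cast_sub hfm.le]
    linarith
  · intro j hj
    by_contra hlt
    have hsub : ((A ++ (List.replicate m q ++ B)).take j).Sublist
        (A ++ List.replicate (m - f - 1) q) := by
      rw [← key (m - f - 1) (by omega)]
      exact (List.take_prefix_take_left (by omega)).sublist
    have hle := hsub.sum_le_sum (by
      intro x hx
      rcases List.mem_append.1 hx with h | h
      · exact hA0 x h
      · rw [List.eq_of_mem_replicate h]; exact hq.le)
    simp only [List.sum_append, List.sum_replicate, nsmul_eq_mul] at hle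
    have : ((m - f - 1 : ℕ) : ℝ) = m - f - 1 := by
      rw [Nat.sub_sub, Nat.cast_sub (by omega)]; push_cast; ring
    rw [this] at hle
    linarith

lemma aux_sort (MA MB : Multiset ℝ) (m : ℕ) (q : ℝ) (hA : ∀ x ∈ MA, q ≤ x)
    (hB : ∀ x ∈ MB, x ≤ q) :
    ((MA + (Multiset.replicate m q + MB)).sort (· ≤ ·)).reverse =
      MA.sort (· ≥ ·) ++ (List.replicate m q ++ MB.sort (· ≥ ·)) := by
  apply List.Perm.eq_of_pairwise (le := (· ≥ ·))
  · intro a b _ _ h1 h2; exact le_antisymm h2 h1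
  · rw [List.pairwise_reverse]; exact Multiset.pairwise_sort _ _
  · rw [List.pairwise_append, List.pairwise_append]
    refine ⟨Multiset.pairwise_sort _ _, ⟨by simp [List.pairwise_replicate],
      Multiset.pairwise_sort _ _, ?_⟩, ?_⟩
    · intro a ha b hb
      rw [List.eq_of_mem_replicate ha]
      exact hB b (by simpa using hb)
    · intro a ha b hb
      have ha' := hA a (by simpa using ha)
      rcases List.mem_append.1 hb with h | h
      · rw [List.eq_of_mem_replicate h]; exact ha'
      · exact (hB b (by simpa using h)).trans ha'
  · rw [← Multiset.coe_eq_coe, ← Multiset.coe_add, ← Multiset.coe_add, Multiset.coe_reverse]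
    simp [Multiset.coe_replicate]

/-- For a multiset containing each `p_l` (`0 < p_0 < … < p_n`) with
multiplicity `n_l`, with `s_r = ∑_{i=1}^r n_{n-i+1} p_{n-i+1}` the sum of the `r`
largest distinct values counted with multiplicity, `0 ≤ ε < 1` with `s_{n+1} ≥ 1 - ε`,
and `b = min{r : s_r ≥ 1 - ε}` (assumed `≥ 1`), the smallest `k` such that the sum of
the `k` largest elements of the multiset is at least `1 - ε` is
`k = ∑_{i=1}^b n_{n-i+1} - ⌊(s_b - (1 - ε))/p_{n-b+1}⌋`. -/
theorem stmt17 (n : ℕ) (p : Fin (n + 1) → ℝ) (hpos : ∀ i, 0 < p i)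
    (hmono : StrictMono p) (mult : Fin (n + 1) → ℕ) (hmult : ∀ i, 0 < mult i)
    (M : Multiset ℝ) (hM : M = ∑ i : Fin (n + 1), Multiset.replicate (mult i) (p i))
    (s : ℕ → ℝ)
    (hs : ∀ r, s r = ∑ i : Fin (n + 1), if n - (i : ℕ) < r then (mult i : ℝ) * p i else 0)
    (ε : ℝ) (hε0 : 0 ≤ ε) (hε1 : ε < 1) (hstot : 1 - ε ≤ s (n + 1))
    (b : ℕ) (hb1 : 1 ≤ b) (hbn : b ≤ n + 1) (hsb : 1 - ε ≤ s b)
    (hbmin : ∀ r, 1 - ε ≤ s r → b ≤ r)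
    (k : ℕ)
    (hk : k = (∑ i : Fin (n + 1), if n - (i : ℕ) < b then mult i else 0) -
        Nat.floor ((s b - (1 - ε)) / p ⟨n + 1 - b, by omega⟩)) :
    1 - ε ≤ (((M.sort (· ≤ ·)).reverse).take k).sum ∧
    ∀ j, 1 - ε ≤ (((M.sort (· ≤ ·)).reverse).take j).sum → k ≤ j := by
  obtain ⟨c, hc⟩ : ∃ c : Fin (n + 1), c = ⟨n + 1 - b, by omega⟩ := ⟨_, rfl⟩
  rw [← hc] at hk
  have hcv : (c : ℕ) = n + 1 - b := by rw [hc]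
  -- splitting of sums
  have hlt : ∀ i : Fin (n + 1), n - (i : ℕ) < b - 1 ↔ c < i := by
    intro i; rw [Fin.lt_def]; have := i.2; omega
  have hle : ∀ i : Fin (n + 1), n - (i : ℕ) < b ↔ c ≤ i := by
    intro i; rw [Fin.le_def]; have := i.2; omega
  have hsplit : (Finset.univ.filter (fun i => c ≤ i)) = insert c (Finset.univ.filter (fun i => c < i)) := by
    ext i; simp [le_iff_eq_or_lt, eq_comm]
  have hnot : c ∉ (Finset.univ.filter (fun i => c < i)) := by simp
  set MA : Multiset ℝ := ∑ i ∈ Finset.univ.filter (fun i => c < i), Multiset.replicate (mult i) (p i)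
    with hMA
  set MB : Multiset ℝ := ∑ i ∈ Finset.univ.filter (fun i => ¬ c ≤ i), Multiset.replicate (mult i) (p i)
    with hMB
  have hMeq : M = MA + (Multiset.replicate (mult c) (p c) + MB) := by
    rw [hM, ← Finset.sum_filter_add_sum_filter_not Finset.univ (fun i => c ≤ i), hsplit,
      Finset.sum_insert hnot, ← hMA, ← hMB]
    abel
  have hsA : s (b - 1) = MA.sum := by
    rw [hs, hMA, ← Multiset.coe_sumAddMonoidHom, map_sum]
    simp only [hlt, Multiset.coe_sumAddMonoidHom, Multiset.sum_replicate, nsmul_eq_mul]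
    rw [Finset.sum_filter]
  have hsB : s b = MA.sum + mult c * p c := by
    rw [← hsA, hs, hs]
    simp only [hlt, hle]
    rw [← Finset.sum_filter, ← Finset.sum_filter, hsplit, Finset.sum_insert hnot, add_comm]
  have hcard : (∑ i : Fin (n + 1), if n - (i : ℕ) < b then mult i else 0) = MA.card + mult c := by
    simp only [hle]
    rw [← Finset.sum_filter, hsplit, Finset.sum_insert hnot, add_comm, hMA, Multiset.card_sum]
    simp
  have hAm : ∀ x ∈ MA, p c ≤ x := by
    intro x hx
    rw [hMA, Multiset.mem_sum] at hx
    obtain ⟨i, hi, hx⟩ := hx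
    rw [Multiset.eq_of_mem_replicate hx]
    exact (hmono (Finset.mem_filter.1 hi).2).le
  have hBm : ∀ x ∈ MB, x ≤ p c := by
    intro x hx
    rw [hMB, Multiset.mem_sum] at hx
    obtain ⟨i, hi, hx⟩ := hx
    rw [Multiset.eq_of_mem_replicate hx]
    exact (hmono (not_le.1 (Finset.mem_filter.1 hi).2)).le
  have hsum : (MA.sort (· ≥ ·)).sum = MA.sum := by
    rw [← Multiset.sum_coe, Multiset.sort_eq]
  have hAlt : MA.sum < 1 - ε := by
    rw [← hsA]
    by_contra h
    have := hbmin _ (not_lt.1 h)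
    omega
  rw [hMeq, aux_sort MA MB _ _ hAm hBm]
  apply aux_list _ _ _ _ _ (hpos c)
  · rw [hsum]; exact hAlt
  · rw [hsum, ← hsB]; exact hsb
  · intro x hx
    exact (hpos c).le.trans (hAm x (by simpa using hx))
  · rw [hk, hsum, ← hsB, hcard, Multiset.length_sort]
end
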